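/- Let c1, c2, c3, c4 be generic real numbers, N ≥ 0 an integer, and c0 = −2N−3−c1−c2−c3−c4. For all integers i, j, k, ℓ ≥ 0 with i+j ≤ N and k+ℓ ≤ N, the Tratnik polynomials of Racah type satisfy the orthogonality relation Σ over integers x, y ≥ 0 with x+y ≤ N of Λ(x; c1,c2; N) · Ω(y; c4,c0,c3; N−x) · T_{i,j}(x,y) · T_{k,ℓ}(x,y) = δ_{i,k} · δ_{j,ℓ} · Λ(j; c4,c0; N) · Ω(i; c1,c2,c3; N−j). -/

import Mathlib

open Finset

noncomputable section

/-- Pochhammer symbol `(a)_k = a (a+1) ⋯ (a+k-1)`. -/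
def poch (a : ℝ) (k : ℕ) : ℝ := ∏ i ∈ Finset.range k, (a + i)

/-- A real number is *generic* if it is not an integer. -/
def Generic (r : ℝ) : Prop := ∀ m : ℤ, r ≠ (m : ℝ)

/-- Genericity for three parameters: none of the parameters, nor any sum of two or three
of them, is an integer; this guarantees that no denominator vanishes. -/
def Generic3 (c1 c2 c3 : ℝ) : Prop :=
  Generic c1 ∧ Generic c2 ∧ Generic c3 ∧
  Generic (c1+c2) ∧ Generic (c1+c3) ∧ Generic (c2+c3) ∧
  Generic (c1+c2+c3)

/-- Genericity for four parameters: none of the parameters, nor any sum of two, three or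
four of them, is an integer; this guarantees that no denominator vanishes. -/
def Generic4 (c1 c2 c3 c4 : ℝ) : Prop :=
  Generic c1 ∧ Generic c2 ∧ Generic c3 ∧ Generic c4 ∧
  Generic (c1+c2) ∧ Generic (c1+c3) ∧ Generic (c1+c4) ∧
  Generic (c2+c3) ∧ Generic (c2+c4) ∧ Generic (c3+c4) ∧
  Generic (c1+c2+c3) ∧ Generic (c1+c2+c4) ∧ Generic (c1+c3+c4) ∧ Generic (c2+c3+c4) ∧
  Generic (c1+c2+c3+c4)

/-- Normalization `Ω(n; c1,c2,c3; M)`. -/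
def Om (n : ℤ) (c1 c2 c3 : ℝ) (M : ℤ) : ℝ :=
  (M.toNat.choose n.toNat : ℝ) * (2*(n:ℝ) + c2 + c3 + 1) *
    poch (c2+1) n.toNat * poch ((M:ℝ)+2+c1+c2+c3) n.toNat * poch (c1+1) (M-n).toNat /
    (poch (c3+1) n.toNat * poch (c2+c3+(n:ℝ)+1) (M.toNat+1))

/-- The renormalized Racah polynomial `p_n(x; c1,c2,c3; M)`, with the convention that it
vanishes unless `0 ≤ n ≤ M`. -/
def racah (n : ℤ) (x : ℝ) (c1 c2 c3 : ℝ) (M : ℤ) : ℝ :=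
  if 0 ≤ n ∧ n ≤ M then
    Om n c1 c2 c3 M *
      ∑ k ∈ Finset.range (n.toNat + 1),
        (poch (-(n:ℝ)) k * poch ((n:ℝ)+c2+c3+1) k * poch (-x) k * poch (x+c1+c2+1) k) /
        (poch (c2+1) k * poch ((M:ℝ)+2+c1+c2+c3) k * poch (-(M:ℝ)) k * (Nat.factorial k : ℝ))
  else 0

/-- Weight `Λ(x; c1,c2; M)`. -/
def Lam (x : ℤ) (c1 c2 : ℝ) (M : ℤ) : ℝ :=
  (-1:ℝ)^x.toNat * (M.toNat.choose x.toNat : ℝ) * (2*(x:ℝ)+c1+c2+1) * poch (c2+1) x.toNat /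
    (poch (c1+1) x.toNat * poch ((x:ℝ)+c1+c2+1) (M.toNat+1))

/-- `λ(x; c) = x(x+c+1)`. -/
def lam (x c : ℝ) : ℝ := x*(x+c+1)

/-- `μ_n(c) = n(n+c+1)`. -/
def mu (n c : ℝ) : ℝ := n*(n+c+1)

/-- Recurrence coefficient `A_n(c1,c2,c3; M)`. -/
def coefA (n c1 c2 c3 M : ℝ) : ℝ :=
  (n-M)*(n+c1+c2+c3+M+2)*(n+c2+1)*(n+c2+c3+1)/((2*n+c2+c3+1)*(2*n+c2+c3+2))

/-- Recurrence coefficient `C_n(c1,c2,c3; M)`. -/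
def coefC (n c1 c2 c3 M : ℝ) : ℝ :=
  n*(n-c1-M-1)*(n+c2+c3+M+1)*(n+c3)/((2*n+c2+c3)*(2*n+c2+c3+1))

/-- `Σ_n = A_n + C_n`. -/
def coefSig (n c1 c2 c3 M : ℝ) : ℝ := coefA n c1 c2 c3 M + coefC n c1 c2 c3 M

/-- Difference coefficient `B(x; c1,c2,c3; M)`. -/
def coefB (x c1 c2 c3 M : ℝ) : ℝ :=
  (x-M)*(x+c2+1)*(x+c1+c2+c3+M+2)*(x+c1+c2+1)/((2*x+c1+c2+1)*(2*x+c1+c2+2))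

/-- Difference coefficient `D(x; c1,c2,c3; M)`. -/
def coefD (x c1 c2 c3 M : ℝ) : ℝ :=
  x*(x+c1)*(x-c3-M-1)*(x+c1+c2+M+1)/((2*x+c1+c2)*(2*x+c1+c2+1))

/-- `S = B + D`. -/
def coefS (x c1 c2 c3 M : ℝ) : ℝ := coefB x c1 c2 c3 M + coefD x c1 c2 c3 M

/-- `F(x; c1,c2)`. -/
def Ffun (x c1 c2 : ℝ) : ℝ :=
  (x+c2+1)*(x+c1+c2+1)/((2*x+c1+c2+1)*(2*x+c1+c2+2))

/-- `λ⁺(x; c12; M) = (x+c12+M+2)(x−M−1)`. -/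
def lamP (x c12 M : ℝ) : ℝ := (x+c12+M+2)*(x-M-1)

/-- `A⁺_n(c2,c3; M)`. -/
def Ap (n c2 c3 M : ℝ) : ℝ := -(n-M-1)*(n-M)*Ffun n c3 c2

/-- `C⁺_n(c2,c3; M) = A⁺_{−n−c23−1}(c2,c3; M)`. -/
def Cp (n c2 c3 M : ℝ) : ℝ := Ap (-n-c2-c3-1) c2 c3 M

/-- `Σ⁺_n = A⁺_n + C⁺_n + (M+1)(M+1+c3)`. -/
def Sp (n c2 c3 M : ℝ) : ℝ := Ap n c2 c3 M + Cp n c2 c3 M + (M+1)*(M+1+c3)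

/-- `λ⁻(x; c123, c3; M) = (x+c123+M+1)(x−M−c3)`. -/
def lamM (x c123 c3 M : ℝ) : ℝ := (x+c123+M+1)*(x-M-c3)

/-- `A⁻_n(c1,c2,c3; M)`. -/
def Am (n c1 c2 c3 M : ℝ) : ℝ := -(n+c1+c2+c3+M+1)*(n+c1+c2+c3+M+2)*Ffun n c3 c2

/-- `C⁻_n(c1,c2,c3; M) = A⁻_{−n−c23−1}(c1,c2,c3; M)`. -/
def Cm (n c1 c2 c3 M : ℝ) : ℝ := Am (-n-c2-c3-1) c1 c2 c3 M

/-- `Σ⁻_n = A⁻_n + C⁻_n + (M+c12+1)(M+c123+1)`. -/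
def Sm (n c1 c2 c3 M : ℝ) : ℝ :=
  Am n c1 c2 c3 M + Cm n c1 c2 c3 M + (M+c1+c2+1)*(M+c1+c2+c3+1)

/-- `μ⁺_n(c123, c1; M) = (n+c123+M+2)(n−M−1−c1)`. -/
def muP (n c123 c1 M : ℝ) : ℝ := (n+c123+M+2)*(n-M-1-c1)

/-- `B⁺(x; c1,c2,c3; M)`. -/
def Bp (x c1 c2 c3 M : ℝ) : ℝ := -(x+c1+c2+c3+M+2)*(x+c1+c2+c3+M+3)*Ffun x c1 c2

/-- `D⁺(x; c1,c2,c3; M) = B⁺(−x−c12−1; c1,c2,c3; M)`. -/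
def Dp (x c1 c2 c3 M : ℝ) : ℝ := Bp (-x-c1-c2-1) c1 c2 c3 M

/-- `S⁺ = B⁺ + D⁺ + (c23+M+2)(c123+M+2)`. -/
def SpD (x c1 c2 c3 M : ℝ) : ℝ :=
  Bp x c1 c2 c3 M + Dp x c1 c2 c3 M + (c2+c3+M+2)*(c1+c2+c3+M+2)

/-- `μ⁻_n(c23; M) = (n−M)(n+c23+M+1)`. -/
def muM (n c23 M : ℝ) : ℝ := (n-M)*(n+c23+M+1)

/-- `B⁻(x; c1,c2; M)`. -/
def Bm (x c1 c2 M : ℝ) : ℝ := -(x-M)*(x-M+1)*Ffun x c1 c2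

/-- `D⁻(x; c1,c2; M) = B⁻(−x−c12−1; c1,c2; M)`. -/
def Dm (x c1 c2 M : ℝ) : ℝ := Bm (-x-c1-c2-1) c1 c2 M

/-- `S⁻ = B⁻ + D⁻ + M(c1+M)`. -/
def SmD (x c1 c2 M : ℝ) : ℝ := Bm x c1 c2 M + Dm x c1 c2 M + M*(c1+M)

/-- Nine-point recurrence coefficients `A^{e,e'}_{i,j}(c1,c2,c3,c4)` (with
`c0 = −2N−3−c1−c2−c3−c4`). -/
def nineA (e e' : ℤ) (i j : ℝ) (c1 c2 c3 c4 N : ℝ) : ℝ :=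
  let c0 : ℝ := -2*N-3-c1-c2-c3-c4
  if e = 1 ∧ e' = 1 then -(Ffun (-j-c0-c4-1) c4 c0) * Cm i c1 c2 c3 (N-j+1)
  else if e = 0 ∧ e' = 1 then (Ffun (-j-c0-c4-1) c4 c0) * Sm i c1 c2 c3 (N-j+1)
  else if e = -1 ∧ e' = 1 then -(Ffun (-j-c0-c4-1) c4 c0) * Am i c1 c2 c3 (N-j+1)
  else if e = 1 ∧ e' = -1 then -(Ffun j c4 c0) * Cp i c2 c3 (N-j-1)
  else if e = 0 ∧ e' = -1 then (Ffun j c4 c0) * Sp i c2 c3 (N-j-1)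
  else if e = -1 ∧ e' = -1 then -(Ffun j c4 c0) * Ap i c2 c3 (N-j-1)
  else if e = 1 ∧ e' = 0 then (Ffun j c4 c0 + Ffun (-j-c0-c4-1) c4 c0) * coefC i c1 c2 c3 (N-j)
  else if e = 0 ∧ e' = 0 then
    -(Ffun j c4 c0 + Ffun (-j-c0-c4-1) c4 c0) *
      (coefSig i c1 c2 c3 (N-j) + (N-j)^2 + (c1+c2+c3+2)*(N-j) + (1/2)*(c3+1)*(c1+c2+c3+1))
  else if e = -1 ∧ e' = 0 then (Ffun j c4 c0 + Ffun (-j-c0-c4-1) c4 c0) * coefA i c1 c2 c3 (N-j)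
  else 0

/-- `Γ^{0,0}_{i,j}(c1,c2,c3,c4)`. -/
def gam00 (i j : ℝ) (c1 c2 c3 c4 N : ℝ) : ℝ :=
  let c0 : ℝ := -2*N-3-c1-c2-c3-c4
  (-(coefSig i c1 c2 c3 (N-j)) + coefSig j c1 c0 c4 (N-i) - (1/4)*(c3^2-c4^2)
    + (i-N-(1/2)*(c4+1))*(i+(1/2)*(c2+c3-c0-c1))
    - (j-N-(1/2)*(c3+1))*(j+(1/2)*(c0+c4-c1-c2)))

/-- `Γ^{e,e'}_{i,j}` coefficients. -/
def gam (e e' : ℤ) (i j : ℝ) (c1 c2 c3 c4 N : ℝ) : ℝ :=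
  let c0 : ℝ := -2*N-3-c1-c2-c3-c4
  if e = 0 ∧ e' = 1 then coefC j c1 c0 c4 (N-i)
  else if e = 0 ∧ e' = -1 then coefA j c1 c0 c4 (N-i)
  else if e = 1 ∧ e' = 0 then coefC i c1 c2 c3 (N-j)
  else if e = -1 ∧ e' = 0 then coefA i c1 c2 c3 (N-j)
  else if e = 0 ∧ e' = 0 then gam00 i j c1 c2 c3 c4 N
  else 0

/-- Nine-point difference coefficients `D^{e,e'}(x,y; c1,c2,c3,c4)` (with
`c0 = −2N−3−c1−c2−c3−c4`). -/
def nineD (e e' : ℤ) (x y : ℝ) (c1 c2 c3 c4 N : ℝ) : ℝ :=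
  let c0 : ℝ := -2*N-3-c1-c2-c3-c4
  if e = 1 ∧ e' = 1 then -(Ffun x c1 c2) * Bm y c3 c0 (N-x)
  else if e = 1 ∧ e' = 0 then (Ffun x c1 c2) * SmD y c3 c0 (N-x)
  else if e = 1 ∧ e' = -1 then -(Ffun x c1 c2) * Dm y c3 c0 (N-x)
  else if e = -1 ∧ e' = 1 then -(Ffun (-x-c1-c2-1) c1 c2) * Bp y c3 c0 c4 (N-x)
  else if e = -1 ∧ e' = 0 then (Ffun (-x-c1-c2-1) c1 c2) * SpD y c3 c0 c4 (N-x)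
  else if e = -1 ∧ e' = -1 then -(Ffun (-x-c1-c2-1) c1 c2) * Dp y c3 c0 c4 (N-x)
  else if e = 0 ∧ e' = 1 then (Ffun x c1 c2 + Ffun (-x-c1-c2-1) c1 c2) * coefB y c3 c0 c4 (N-x)
  else if e = 0 ∧ e' = 0 then
    -(Ffun x c1 c2 + Ffun (-x-c1-c2-1) c1 c2) *
      (coefS y c3 c0 c4 (N-x) + (N-x)^2 + (c0+c3+c4+2)*(N-x) + (1/2)*(c3+1)*(c0+c3+c4+1))
  else if e = 0 ∧ e' = -1 then (Ffun x c1 c2 + Ffun (-x-c1-c2-1) c1 c2) * coefD y c3 c0 c4 (N-x)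
  else 0

/-- `Ψ^{a,b}(x,y)` coefficients: the first superscript refers to the shift in `y`,
the second to the shift in `x` (with `c0 = −2N−3−c1−c2−c3−c4`). -/
def psi (a b : ℤ) (x y : ℝ) (c1 c2 c3 c4 N : ℝ) : ℝ :=
  let c0 : ℝ := -2*N-3-c1-c2-c3-c4
  if a = 0 ∧ b = 1 then coefB x c4 c2 c1 (N-y)
  else if a = 0 ∧ b = -1 then coefD x c4 c2 c1 (N-y)
  else if a = 1 ∧ b = 0 then coefB y c3 c0 c1 (N-x)
  else if a = -1 ∧ b = 0 then coefD y c3 c0 c1 (N-x)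
  else if a = 0 ∧ b = 0 then gam00 x y c1 c2 c4 c3 N
  else 0

/-- Tratnik polynomial of Racah type `T_{i,j}(x,y; c1,c2,c3,c4; N)`, set to `0` outside
the triangular domains. -/
def trat (c1 c2 c3 c4 : ℝ) (Nn : ℕ) (i j x y : ℤ) : ℝ :=
  let c0 : ℝ := -2*(Nn:ℝ)-3-c1-c2-c3-c4
  if 0 ≤ i ∧ 0 ≤ j ∧ i + j ≤ (Nn:ℤ) ∧ 0 ≤ x ∧ 0 ≤ y ∧ x + y ≤ (Nn:ℤ) then
    racah i (x:ℝ) c1 c2 c3 ((Nn:ℤ)-j) * racah j (y:ℝ) c3 c0 c4 ((Nn:ℤ)-x)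
  else 0

/-- Griffiths polynomial of Racah type `G_{i,j}(x,y; c1,c2,c3,c4; N)`, set to `0` outside
the triangular domains. -/
def grif (c1 c2 c3 c4 : ℝ) (Nn : ℕ) (i j x y : ℤ) : ℝ :=
  let c0 : ℝ := -2*(Nn:ℝ)-3-c1-c2-c3-c4
  if 0 ≤ i ∧ 0 ≤ j ∧ i + j ≤ (Nn:ℤ) ∧ 0 ≤ x ∧ 0 ≤ y ∧ x + y ≤ (Nn:ℤ) then
    ∑ a ∈ Finset.range (((Nn:ℤ)-j).toNat + 1),
      (-1:ℝ)^a * racah i (a:ℝ) c1 c2 c3 ((Nn:ℤ)-j) * racah j (y:ℝ) c3 c0 c4 ((Nn:ℤ)-(a:ℤ)) *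
        racah (a:ℤ) (x:ℝ) c4 c2 c1 ((Nn:ℤ)-y)
  else 0

/-- Krawtchouk polynomial `K_n(x; p; M)`, set to `0` unless `0 ≤ n ≤ M`. -/
def kraw (n : ℤ) (x : ℝ) (p : ℝ) (M : ℤ) : ℝ :=
  if 0 ≤ n ∧ n ≤ M then
    (M.toNat.choose n.toNat : ℝ) * (p/(1-p))^n.toNat *
      ∑ k ∈ Finset.range (n.toNat + 1),
        poch (-(n:ℝ)) k * poch (-x) k / (poch (-(M:ℝ)) k * (Nat.factorial k : ℝ)) * (1/p)^k
  else 0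

lemma poch_zero (a : ℝ) : poch a 0 = 1 := by simp [poch]

lemma poch_succ (a : ℝ) (k : ℕ) : poch a (k+1) = poch a k * (a + k) := by
  simp [poch, Finset.prod_range_succ]

lemma poch_succ_left (a : ℝ) (k : ℕ) : poch a (k+1) = a * poch (a+1) k := by
  unfold poch
  rw [Finset.prod_range_succ', mul_comm]
  congr 1
  · simp
  · exact Finset.prod_congr rfl fun i _ => by push_cast; ring

lemma poch_shift (a : ℝ) (k : ℕ) : poch a k * (a + k) = a * poch (a+1) k := by
  rw [← poch_succ, poch_succ_left]

lemma poch_ne_zero {a : ℝ} {k : ℕ} (h : ∀ i < k, a + i ≠ 0) : poch a k ≠ 0 :=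
  Finset.prod_ne_zero_iff.2 fun i hi => h i (Finset.mem_range.1 hi)

lemma poch_neg_eq_zero {n k : ℕ} (h : n < k) : poch (-(n:ℝ)) k = 0 :=
  Finset.prod_eq_zero (Finset.mem_range.2 h) (by simp)

lemma poch_add_reflect (u : ℝ) (m j : ℕ) :
    poch u (m+j) = (-1)^j * poch (-(u+m+j-1)) j * poch u m := by
  induction j with
  | zero => simp [poch_zero]
  | succ j ih =>
    rw [← add_assoc, poch_succ, ih, poch_succ_left]
    have : -(u + m + ((j+1:ℕ):ℝ) - 1) + 1 = -(u+m+j-1) := by push_cast; ring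
    rw [this]
    push_cast
    ring

lemma Generic.add_intCast_ne_zero {r : ℝ} (h : Generic r) (m : ℤ) : r + m ≠ 0 :=
  fun h0 => h (-m) (by push_cast; linarith)

lemma Generic.poch_ne_zero {r a : ℝ} (h : Generic r) (m : ℤ) (ha : a = r + m) (k : ℕ) :
    poch a k ≠ 0 :=
  _root_.poch_ne_zero fun i _ => by
    have := h.add_intCast_ne_zero (m + i)
    push_cast at this
    rwa [ha, add_assoc]

lemma Generic.int_sub {r s : ℝ} (h : Generic r) (m : ℤ) (hs : s = m - r) : Generic s :=
  fun n hn => h (m - n) (by push_cast; linarith)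

lemma Generic3.reverse {c1 c2 c3 : ℝ} (h : Generic3 c1 c2 c3) : Generic3 c3 c2 c1 := by
  obtain ⟨h1, h2, h3, h12, h13, h23, h123⟩ := h
  refine ⟨h3, h2, h1, ?_, ?_, ?_, ?_⟩
  · rwa [add_comm]
  · rwa [add_comm]
  · rwa [add_comm]
  · rwa [show c3 + c2 + c1 = c1 + c2 + c3 by ring]

/-- `Ω(n; c1,c2,c3; M)` for natural `n`, `M`. -/
def racahWeight (c1 c2 c3 : ℝ) (M n : ℕ) : ℝ :=
  (M.choose n : ℝ) * (2*(n:ℝ) + c2 + c3 + 1) *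
    poch (c2+1) n * poch ((M:ℝ)+2+c1+c2+c3) n * poch (c1+1) (M-n) /
    (poch (c3+1) n * poch (c2+c3+(n:ℝ)+1) (M+1))

/-- The coefficients of the terminating `₄F₃` series defining the Racah polynomials. -/
def racahCoeff (c1 c2 c3 : ℝ) (M n k : ℕ) : ℝ :=
  poch (-(n:ℝ)) k * poch ((n:ℝ)+c2+c3+1) k /
    (poch (c2+1) k * poch ((M:ℝ)+2+c1+c2+c3) k * poch (-(M:ℝ)) k * (Nat.factorial k : ℝ))

/-- The basis functions `(-x)_k (x+s)_k`. -/
def racahBasis (s : ℝ) (k : ℕ) (x : ℝ) : ℝ := poch (-x) k * poch (x+s) k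

/-- The unnormalized Racah polynomial, a terminating `₄F₃` series. -/
def racahSeries (c1 c2 c3 : ℝ) (M n : ℕ) (x : ℝ) : ℝ :=
  ∑ k ∈ Finset.range (M+1), racahCoeff c1 c2 c3 M n k * racahBasis (c1+c2+1) k x

lemma racahSeries_duality (c1 c2 c3 : ℝ) (M n x : ℕ) :
    racahSeries c1 c2 c3 M n x = racahSeries c3 c2 c1 M x n := by
  refine Finset.sum_congr rfl fun k _ => ?_
  simp only [racahCoeff, racahBasis]
  rw [show (M:ℝ)+2+c3+c2+c1 = M+2+c1+c2+c3 by ring, show (n:ℝ)+(c3+c2+1) = n+c2+c3+1 by ring,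
    show (x:ℝ)+c2+c1+1 = x+(c1+c2+1) by ring]
  ring

lemma racahSeries_zero (c1 c2 c3 : ℝ) (M n : ℕ) : racahSeries c1 c2 c3 M n 0 = 1 := by
  unfold racahSeries
  rw [Finset.sum_range_succ', Finset.sum_eq_zero]
  · simp [racahCoeff, racahBasis, poch_zero]
  · intro k _
    have : poch (-((0:ℕ):ℝ)) (k+1) = 0 := poch_neg_eq_zero (Nat.succ_pos k)
    rw [Nat.cast_zero] at this
    rw [racahBasis, this, zero_mul, mul_zero]

lemma racahBasis_succ (s : ℝ) (k : ℕ) (x : ℝ) :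
    racahBasis s (k+1) x = (k-x)*(x+s+k) * racahBasis s k x := by
  simp only [racahBasis, poch_succ]; ring

lemma racahBasis_shift_up (s : ℝ) (k : ℕ) (x : ℝ) :
    (x+s) * racahBasis s (k+1) (x+1) = -(x+1)*(x+s+k)*(x+s+k+1) * racahBasis s k x := by
  have h1 := poch_shift (x+s) k
  have h2 : poch (-(x+1)) (k+1) = -(x+1) * poch (-x) k := by
    rw [poch_succ_left]; congr 2; ring
  simp only [racahBasis, h2]
  rw [poch_succ, show x+1+s = x+s+1 by ring]
  linear_combination (x+1) * poch (-x) k * (x+s+1+k) * h1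

lemma racahBasis_shift_down (s : ℝ) (k : ℕ) (x : ℝ) :
    x * racahBasis s (k+1) (x-1) = -(k-x)*(k+1-x)*(x+s-1) * racahBasis s k x := by
  have h1 := poch_shift (-x) k
  have h2 : poch (x-1+s) (k+1) = (x+s-1) * poch (x+s) k := by
    rw [poch_succ_left, show x-1+s+1 = x+s by ring]; ring
  simp only [racahBasis, h2]
  rw [poch_succ, show -(x-1) = -x+1 by ring]
  linear_combination (x+s-1) * poch (x+s) k * (-x+1+k) * h1

lemma racahBasis_difference_zero (s x y : ℝ) :
    racahBasis s 0 y - racahBasis s 0 x = 0 := by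
  simp [racahBasis, poch_zero]

/-- Action of the Racah difference operator on the basis functions. -/
lemma racahBasis_difference_succ (c1 c2 c3 M x : ℝ) (k : ℕ)
    (h0 : 2*x+c1+c2 ≠ 0) (h1 : 2*x+c1+c2+1 ≠ 0) (h2 : 2*x+c1+c2+2 ≠ 0) :
    coefB x c1 c2 c3 M * (racahBasis (c1+c2+1) (k+1) (x+1) - racahBasis (c1+c2+1) (k+1) x) +
      coefD x c1 c2 c3 M * (racahBasis (c1+c2+1) (k+1) (x-1) - racahBasis (c1+c2+1) (k+1) x) =
    ((k:ℝ)+1)*(k+1+c2+c3+1) * racahBasis (c1+c2+1) (k+1) x -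
      ((k:ℝ)+1)*(c2+1+k)*(M+2+c1+c2+c3+k)*(-M+k) * racahBasis (c1+c2+1) k x := by
  have hu := racahBasis_shift_up (c1+c2+1) k x
  have hd := racahBasis_shift_down (c1+c2+1) k x
  have hs := racahBasis_succ (c1+c2+1) k x
  have hB : coefB x c1 c2 c3 M * racahBasis (c1+c2+1) (k+1) (x+1) =
      (x-M)*(x+c2+1)*(x+c1+c2+c3+M+2)/((2*x+c1+c2+1)*(2*x+c1+c2+2)) *
        (-(x+1)*(x+(c1+c2+1)+k)*(x+(c1+c2+1)+k+1) * racahBasis (c1+c2+1) k x) := by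
    rw [← hu, coefB]; ring
  have hD : coefD x c1 c2 c3 M * racahBasis (c1+c2+1) (k+1) (x-1) =
      (x+c1)*(x-c3-M-1)*(x+c1+c2+M+1)/((2*x+c1+c2)*(2*x+c1+c2+1)) *
        (-(k-x)*(k+1-x)*(x+(c1+c2+1)-1) * racahBasis (c1+c2+1) k x) := by
    rw [← hd, coefD]; ring
  rw [mul_sub, mul_sub, hB, hD, hs]
  simp only [coefB, coefD]
  generalize racahBasis (c1+c2+1) k x = f
  obtain ⟨u, rfl⟩ : ∃ u, c2 = u - 2*x - c1 := ⟨2*x+c1+c2, by ring⟩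
  have e0 : 2*x+c1+(u-2*x-c1) = u := by ring
  rw [e0] at h0 h1 h2 ⊢
  field_simp
  ring

lemma racahCoeff_succ {c1 c2 c3 : ℝ} (h : Generic3 c1 c2 c3) {M : ℕ} (n : ℕ) {k : ℕ} (hk : k < M) :
    racahCoeff c1 c2 c3 M n (k+1) * (((k:ℝ)+1)*(c2+1+k)*(M+2+c1+c2+c3+k)*(-M+k)) =
      racahCoeff c1 c2 c3 M n k * ((-n+k)*(n+c2+c3+1+k)) := by
  obtain ⟨_, h2, _, _, _, _, h123⟩ := h
  have e1 := h2.poch_ne_zero 1 (a := c2+1) (by push_cast; ring) k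
  have e2 := h123.poch_ne_zero (M+2) (a := M+2+c1+c2+c3) (by push_cast; ring) k
  have e3 : poch (-(M:ℝ)) k ≠ 0 := poch_ne_zero fun i hi => by
    have : (i:ℝ) < M := by exact_mod_cast hi.trans hk
    linarith
  have e4 : (Nat.factorial k : ℝ) ≠ 0 := by exact_mod_cast Nat.factorial_ne_zero k
  have e5 : c2+1+k ≠ 0 := by
    have := h2.add_intCast_ne_zero (1+k); push_cast at this; rwa [← add_assoc] at this
  have e6 : (M:ℝ)+2+c1+c2+c3+k ≠ 0 := by
    have := h123.add_intCast_ne_zero (M+2+k); push_cast at this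
    intro h0; exact this (by linarith)
  have e7 : -(M:ℝ)+k ≠ 0 := by
    have : (k:ℝ) < M := by exact_mod_cast hk
    linarith
  have e8 : (k:ℝ)+1 ≠ 0 := by positivity
  simp only [racahCoeff, poch_succ, Nat.factorial_succ]
  push_cast
  field_simp

/-- The Racah difference equation. -/
lemma racahSeries_difference {c1 c2 c3 : ℝ} (h : Generic3 c1 c2 c3) {M n : ℕ} (hn : n ≤ M) (x : ℕ) :
    coefB x c1 c2 c3 M * (racahSeries c1 c2 c3 M n (x+1) - racahSeries c1 c2 c3 M n x) +
      coefD x c1 c2 c3 M * (racahSeries c1 c2 c3 M n (x-1) - racahSeries c1 c2 c3 M n x) =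
    n*(n+c2+c3+1) * racahSeries c1 c2 c3 M n x := by
  obtain ⟨_, _, _, h12, _, _, _⟩ := id h
  have hx (m : ℤ) : 2*(x:ℝ)+c1+c2+m ≠ 0 := by
    have := h12.add_intCast_ne_zero (2*x+m); push_cast at this
    intro h0; exact this (by linarith)
  have h0 : 2*(x:ℝ)+c1+c2 ≠ 0 := by simpa using hx 0
  have h1 : 2*(x:ℝ)+c1+c2+1 ≠ 0 := by simpa using hx 1
  have h2 : 2*(x:ℝ)+c1+c2+2 ≠ 0 := by simpa using hx 2
  set r := racahCoeff c1 c2 c3 M n with hr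
  set f := racahBasis (c1+c2+1) with hf
  have key : ∀ t ≤ M, ∑ k ∈ Finset.range (t+1), r k *
      (coefB x c1 c2 c3 M * (f k (x+1) - f k x) + coefD x c1 c2 c3 M * (f k (x-1) - f k x)
        - n*(n+c2+c3+1) * f k x) = (-n+t)*(n+c2+c3+1+t) * r t * f t x := by
    intro t
    induction t with
    | zero =>
      intro _
      simp only [zero_add, Finset.sum_range_one, hf, racahBasis_difference_zero]
      push_cast; ring
    | succ t ih =>
      intro ht
      rw [Finset.sum_range_succ, ih (by omega)]
      have e1 := racahBasis_difference_succ c1 c2 c3 M x t h0 h1 h2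
      have e2 := racahCoeff_succ h n (show t < M by omega)
      rw [← hf] at e1
      rw [e1]
      rw [← hr] at e2
      push_cast
      linear_combination -(f t x) * e2
  have hend : (-n+M:ℝ)*(n+c2+c3+1+M) * r M = 0 := by
    rcases hn.eq_or_lt with rfl | hlt
    · simp
    · simp [hr, racahCoeff, poch_neg_eq_zero hlt]
  have := key M le_rfl
  rw [hend, zero_mul] at this
  rw [← sub_eq_zero, ← this]
  simp only [racahSeries, ← Finset.sum_sub_distrib, Finset.mul_sum, ← Finset.sum_add_distrib]
  exact Finset.sum_congr rfl fun k _ => by ring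

lemma racahWeight_balance {c1 c2 c3 : ℝ} (h : Generic3 c1 c2 c3) {M x : ℕ} (hx : x < M) :
    racahWeight c3 c2 c1 M x * coefB x c1 c2 c3 M =
      racahWeight c3 c2 c1 M (x+1) * coefD (x+1) c1 c2 c3 M := by
  obtain ⟨h1, h2, _, h12, _, _, h123⟩ := h
  obtain ⟨d, rfl⟩ : ∃ d, M = x + d + 1 := ⟨M - x - 1, by omega⟩
  set M := x + d + 1 with hM
  have hMr : (M:ℝ) = x + d + 1 := by rw [hM]; push_cast; ring
  have hs (m : ℤ) : c1 + c2 + m ≠ 0 := h12.add_intCast_ne_zero m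
  have e1 := h1.poch_ne_zero 1 (a := c1+1) (by push_cast; ring) x
  have e2 := h12.poch_ne_zero (x+1) (a := c2+c1+x+1) (by push_cast; ring) (M+1)
  have e4 : c1+1+x ≠ 0 := by
    have := h1.add_intCast_ne_zero (1+x); push_cast at this; rwa [← add_assoc] at this
  have e5 : 2*(x:ℝ)+c1+c2+1 ≠ 0 := by
    have := hs (2*x+1); push_cast at this; intro h0; exact this (by linarith)
  have e6 : 2*(x:ℝ)+c1+c2+2 ≠ 0 := by
    have := hs (2*x+2); push_cast at this; intro h0; exact this (by linarith)
  have e7 : 2*(x:ℝ)+c1+c2+3 ≠ 0 := by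
    have := hs (2*x+3); push_cast at this; intro h0; exact this (by linarith)
  have e8 : c2+c1+x+1 ≠ 0 := by
    have := hs (x+1); push_cast at this; intro h0; exact this (by linarith)
  have hp := poch_shift (c2+c1+x+1) (M+1)
  have hp' : poch (c2+c1+x+1+1) (M+1) =
      poch (c2+c1+x+1) (M+1) * (c2+c1+x+1+(M+1)) / (c2+c1+x+1) := by
    rw [eq_div_iff e8]; push_cast at hp; linear_combination -hp
  have e9 : c2+c1+x+1+((M:ℝ)+1) ≠ 0 := by
    have := hs (x+M+2); push_cast at this; intro h0; exact this (by linarith)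
  have hc : (M.choose (x+1) : ℝ) = M.choose x * (d+1) / (x+1) := by
    rw [eq_div_iff (by positivity)]
    have := Nat.choose_succ_right_eq M x
    rw [show M - x = d + 1 by omega] at this
    exact_mod_cast this
  have e10 : (x:ℝ)+1 ≠ 0 := by positivity
  have e11 : 2*(x:ℝ)+c2+c1+1 ≠ 0 := by intro h0; exact e5 (by linarith)
  have e12 : 2*((x:ℝ)+1)+c2+c1+1 ≠ 0 := by intro h0; exact e7 (by linarith)
  have hB : coefB x c1 c2 c3 M = -((d:ℝ)+1)*(c2+1+x)*(M+2+c3+c2+c1+x)*(c2+c1+x+1) /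
      ((2*(x:ℝ)+c2+c1+1)*(2*(x:ℝ)+c1+c2+2)) := by
    simp only [coefB, hMr]; congr 1 <;> ring
  have hD : coefD (x+1) c1 c2 c3 M = ((x:ℝ)+1)*(c1+1+x)*(-(c3+1+d))*(c2+c1+x+1+(M+1)) /
      ((2*(x:ℝ)+c1+c2+2)*(2*((x:ℝ)+1)+c2+c1+1)) := by
    simp only [coefD, hMr]; congr 1 <;> ring
  have alg (C P Q R A S p q r y a u u1 u2 v g b : ℝ) (hA : A ≠ 0) (hS : S ≠ 0) (hy : y ≠ 0)
      (ha : a ≠ 0) (hu : u ≠ 0) (hu1 : u1 ≠ 0) (hu2 : u2 ≠ 0) (hv : v ≠ 0) (hg : g ≠ 0) :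
      C*u*P*Q*(R*r)/(A*S) * (-b*p*q*v/(u*u1)) =
        C*b/y*u2*(P*p)*(Q*q)*R/(A*a*(S*g/v)) * (y*a*(-r)*g/(u1*u2)) := by
    field_simp
  rw [hB, hD]
  simp only [racahWeight, hc, show M - x = d + 1 by omega,
    show M - (x+1) = d by omega, poch_succ _ x, poch_succ _ d, Nat.cast_add, Nat.cast_one]
  rw [show c2+c1+((x:ℝ)+1)+1 = c2+c1+x+1+1 by ring, hp']
  exact alg _ _ _ _ _ _ _ _ _ _ _ _ _ _ _ _ _ e1 e2 e10 e4 e11 e6 e12 e8 e9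

/-- Eigenvectors of a symmetrizable tridiagonal operator with distinct eigenvalues are
orthogonal. -/
lemma sum_weight_mul_eq_zero {M : ℕ} {w B D f g : ℕ → ℝ} {μ ν : ℝ} (hμν : μ ≠ ν)
    (hw : ∀ x < M, w x * B x = w (x+1) * D (x+1)) (hB : B M = 0) (hD : D 0 = 0)
    (hf : ∀ x ≤ M, B x * (f (x+1) - f x) + D x * (f (x-1) - f x) = μ * f x)
    (hg : ∀ x ≤ M, B x * (g (x+1) - g x) + D x * (g (x-1) - g x) = ν * g x) :
    ∑ x ∈ Finset.range (M+1), w x * f x * g x = 0 := by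
  have key : ∀ t ≤ M, (μ - ν) * ∑ x ∈ Finset.range (t+1), w x * f x * g x =
      w t * B t * (f (t+1) * g t - f t * g (t+1)) := by
    intro t
    induction t with
    | zero =>
      intro _
      have h1 := hf 0 (Nat.zero_le _)
      have h2 := hg 0 (Nat.zero_le _)
      rw [hD] at h1 h2
      simp only [zero_add, Finset.sum_range_one] at h1 h2 ⊢
      linear_combination -w 0 * g 0 * h1 + w 0 * f 0 * h2
    | succ t ih =>
      intro ht
      rw [Finset.sum_range_succ, mul_add, ih (by omega)]
      have h1 := hf (t+1) ht
      have h2 := hg (t+1) ht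
      have h3 := hw t (by omega)
      rw [Nat.add_sub_cancel] at h1 h2
      linear_combination -w (t+1) * g (t+1) * h1 + w (t+1) * f (t+1) * h2 +
        (f (t+1) * g t - f t * g (t+1)) * h3
  have := key M le_rfl
  rw [hB, mul_zero, zero_mul] at this
  exact (mul_eq_zero.1 this).resolve_left (sub_ne_zero.2 hμν)

lemma racahSeries_orthogonal {c1 c2 c3 : ℝ} (h : Generic3 c1 c2 c3) {M n m : ℕ} (hn : n ≤ M)
    (hm : m ≤ M) (hnm : n ≠ m) :
    ∑ x ∈ Finset.range (M+1), racahWeight c3 c2 c1 M x * racahSeries c1 c2 c3 M n x *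
      racahSeries c1 c2 c3 M m x = 0 := by
  have hpred (i : ℕ) (hi : i ≤ M) (x : ℕ) :
      coefB x c1 c2 c3 M * (racahSeries c1 c2 c3 M i ((x+1 : ℕ):ℝ) - racahSeries c1 c2 c3 M i x) +
      coefD x c1 c2 c3 M * (racahSeries c1 c2 c3 M i ((x-1 : ℕ):ℝ) - racahSeries c1 c2 c3 M i x) =
      i*(i+c2+c3+1) * racahSeries c1 c2 c3 M i x := by
    rw [← racahSeries_difference h hi x]
    rcases x with _ | x
    · simp [coefD]
    · simp
  refine sum_weight_mul_eq_zero (B := fun x => coefB x c1 c2 c3 M)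
    (D := fun x => coefD x c1 c2 c3 M) (f := fun x => racahSeries c1 c2 c3 M n x)
    (g := fun x => racahSeries c1 c2 c3 M m x) (μ := n*(n+c2+c3+1)) (ν := m*(m+c2+c3+1))
    ?_ ?_ ?_ ?_ (fun x _ => hpred n hn x) (fun x _ => hpred m hm x)
  · obtain ⟨_, _, _, _, _, h23, _⟩ := h
    intro h0
    have h1 : ((n:ℝ) - m) * (n + m + c2 + c3 + 1) = 0 := by linear_combination h0
    rcases mul_eq_zero.1 h1 with h1 | h1
    · exact hnm (by exact_mod_cast sub_eq_zero.1 h1)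
    · have := h23.add_intCast_ne_zero (n+m+1)
      push_cast at this
      exact this (by linarith)
  · intro x hx
    simpa using racahWeight_balance h hx
  · simp [coefB]
  · simp [coefD]

lemma racahWeight_succ {c1 c2 c3 : ℝ} (h : Generic3 c1 c2 c3) {M x : ℕ} (hx : x ≤ M) :
    racahWeight c3 c2 c1 (M+1) x =
      racahWeight c3 c2 c1 M x * (((M:ℝ)+1)*(M+2+c1+c2+c3+x)*(c3+1+(M-x)) /
        (((M:ℝ)+1-x)*(M+2+c1+c2+c3)*(c2+c1+x+1+(M+1)))) := by
  obtain ⟨h1, _, _, h12, _, _, h123⟩ := h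
  have e1 := h1.poch_ne_zero 1 (a := c1+1) (by push_cast; ring) x
  have e2 := h12.poch_ne_zero (x+1) (a := c2+c1+x+1) (by push_cast; ring) (M+1)
  have e3 : c2+c1+x+1+((M:ℝ)+1) ≠ 0 := by
    have := h12.add_intCast_ne_zero (x+M+2)
    push_cast at this; intro h0; exact this (by linarith)
  have e4 : (M:ℝ)+2+c1+c2+c3 ≠ 0 := by
    have := h123.add_intCast_ne_zero (M+2)
    push_cast at this; intro h0; exact this (by linarith)
  have e5 : (M:ℝ)+1-x ≠ 0 := by
    have : (x:ℝ) ≤ M := by exact_mod_cast hx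
    intro h0; linarith
  have hc : ((M+1).choose x : ℝ) = M.choose x * (M+1) / (M+1-x) := by
    rw [eq_div_iff e5]
    have := congrArg (Nat.cast (R := ℝ)) (Nat.choose_mul_succ_eq M x)
    push_cast [Nat.cast_sub (show x ≤ M + 1 by omega)] at this
    linarith
  have hp : poch (M+2+c1+c2+c3+1) x =
      poch (M+2+c1+c2+c3) x * (M+2+c1+c2+c3+x) / (M+2+c1+c2+c3) := by
    rw [eq_div_iff e4, poch_shift]; ring
  simp only [racahWeight, hc, show M + 1 - x = (M - x) + 1 by omega, poch_succ _ (M-x),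
    poch_succ _ (M+1), Nat.cast_add, Nat.cast_one, Nat.cast_sub hx]
  rw [show (M:ℝ)+1+2+c3+c2+c1 = M+2+c1+c2+c3+1 by ring, hp,
    show (M:ℝ)+2+c3+c2+c1 = M+2+c1+c2+c3 by ring]
  field_simp

lemma racahWeight_zero_succ {c1 c2 c3 : ℝ} (h : Generic3 c1 c2 c3) (M : ℕ) :
    racahWeight c1 c2 c3 (M+1) 0 =
      racahWeight c1 c2 c3 M 0 * ((c1+1+M) / (c2+c3+2+M)) := by
  obtain ⟨_, _, _, _, _, h23, _⟩ := h
  have e1 : c2+c3+2+M ≠ 0 := by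
    have := h23.add_intCast_ne_zero (2+M)
    push_cast at this; intro h0; exact this (by linarith)
  have e2 := h23.poch_ne_zero 1 (a := c2+c3+1) (by push_cast; ring) (M+1)
  simp only [racahWeight, Nat.choose_zero_right, poch_zero, Nat.sub_zero, poch_succ (c1+1) M,
    poch_succ _ (M+1), Nat.cast_zero, mul_zero, add_zero, zero_add, Nat.cast_one, one_mul, mul_one,
    Nat.cast_add]
  rw [show c2+c3+1+((M:ℝ)+1) = c2+c3+2+M by ring]
  field_simp

lemma racah_wz_identity {c1 c2 c3 M x : ℝ} (h1 : M+1-x ≠ 0) (h2 : M+2+c1+c2+c3 ≠ 0)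
    (h3 : c2+c1+x+1+(M+1) ≠ 0) (h4 : c2+c3+2+M ≠ 0) (h5 : 2*x+c1+c2+1 ≠ 0) :
    (M+1)*(M+2+c1+c2+c3+x)*(c3+1+(M-x)) / ((M+1-x)*(M+2+c1+c2+c3)*(c2+c1+x+1+(M+1))) *
        ((c1+1+M) / (c2+c3+2+M)) - 1 =
      -(2*M+3+c1+c2+c3)/((M+2+c1+c2+c3)*(c2+c3+2+M)) *
        ((x+c2+1)*(M+2+c1+c2+c3+x)*(x+c1+c2+1) / ((c2+c1+x+1+(M+1))*(2*x+c1+c2+1)) -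
          x*(x+c1)*(c3+1+(M-x)) / ((2*x+c1+c2+1)*(M+1-x))) := by
  obtain ⟨u, rfl⟩ : ∃ u, c2 = u - c1 - 2*x - 1 := ⟨2*x+c1+c2+1, by ring⟩
  obtain ⟨w, rfl⟩ : ∃ w, M = w + x - 1 := ⟨M+1-x, by ring⟩
  obtain ⟨z, rfl⟩ : ∃ z, c3 = z - u - w + x := ⟨c3 + u + w - x, by ring⟩
  have e1 : w + x - 1 + 1 - x = w := by ring
  have e2 : w + x - 1 + 2 + c1 + (u - c1 - 2*x - 1) + (z - u - w + x) = z := by ring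
  have e3 : u - c1 - 2*x - 1 + c1 + x + 1 + (w + x - 1 + 1) = u + w := by ring
  have e4 : u - c1 - 2*x - 1 + (z - u - w + x) + 2 + (w + x - 1) = z - c1 := by ring
  have e5 : 2*x + c1 + (u - c1 - 2*x - 1) + 1 = u := by ring
  rw [e1] at h1
  rw [e2] at h2
  rw [e3] at h3
  rw [e4] at h4
  rw [e5] at h5
  rw [e1, e2, e3, e4, e5]
  field_simp
  ring

lemma racahWeight_last {c1 c2 c3 : ℝ} (h : Generic3 c1 c2 c3) (M : ℕ) :
    racahWeight c3 c2 c1 (M+1) (M+1) * (c1+1+M) =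
      racahWeight c3 c2 c1 M M * ((2*M+3+c1+c2+c3)*(M+c2+1)*(2*M+2+c1+c2+c3)*(M+c1+c2+1) /
        ((2*M+c1+c2+1)*(M+2+c1+c2+c3)*(2*M+c1+c2+2))) := by
  have hb := racahWeight_balance h (Nat.lt_succ_self M)
  rw [racahWeight_succ h le_rfl] at hb
  obtain ⟨_, _, h3, h12, _, _, h123⟩ := h
  have e1 : c3 + 1 ≠ 0 := by simpa using h3.add_intCast_ne_zero 1
  have e2 (m : ℤ) : 2*(M:ℝ)+c1+c2+m ≠ 0 := by
    have := h12.add_intCast_ne_zero (2*M+m)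
    push_cast at this; intro h0; exact this (by linarith)
  have e3 := e2 1
  have e4 := e2 2
  have e5 := e2 3
  have e6 : (M:ℝ)+2+c1+c2+c3 ≠ 0 := by
    have := h123.add_intCast_ne_zero (M+2)
    push_cast at this; intro h0; exact this (by linarith)
  have e7 : (M:ℝ)+1 ≠ 0 := by positivity
  push_cast at e3 e4 e5 hb
  generalize racahWeight c3 c2 c1 (M+1) (M+1) = W' at hb ⊢
  generalize racahWeight c3 c2 c1 M M = W at hb ⊢
  generalize (M:ℝ) = m at *
  obtain ⟨u, rfl⟩ : ∃ u, c2 = u - c1 - 2*m := ⟨2*m+c1+c2, by ring⟩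
  obtain ⟨z, rfl⟩ : ∃ z, c3 = z - u + m := ⟨c3 + u - m, by ring⟩
  have hD : coefD (m+1) c1 (u - c1 - 2*m) (z - u + m) (m+1) =
      -((m+1)*(c1+1+m)*(z-u+m+1)) / (u+2) := by
    rw [show 2*m+c1+(u-c1-2*m)+3 = u+3 by ring] at e5
    rw [show 2*m+c1+(u-c1-2*m)+2 = u+2 by ring] at e4
    rw [coefD, show 2*(m+1)+c1+(u-c1-2*m) = u+2 by ring, show u+2+1 = u+3 by ring]
    field_simp
    ring
  have hB : coefB m c1 (u - c1 - 2*m) (z - u + m) (m+1) =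
      -((u-c1-m+1)*(2*m+3+c1+(u-c1-2*m)+(z-u+m))*(u-m+1)) / ((u+1)*(u+2)) := by
    simp only [coefB]; congr 1 <;> ring
  rw [hD, hB] at hb
  rw [show 2*m+c1+(u-c1-2*m)+3 = u+3 by ring] at e5
  rw [show 2*m+c1+(u-c1-2*m)+2 = u+2 by ring] at e4
  rw [show 2*m+c1+(u-c1-2*m)+1 = u+1 by ring] at e3
  rw [show m+2+c1+(u-c1-2*m)+(z-u+m) = z+2 by ring] at e6
  rw [show m+2+c1+(u-c1-2*m)+(z-u+m) = z+2 by ring,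
    show u-c1-2*m+c1+m+1+(m+1) = u+2 by ring, show m+1-m = 1 by ring] at hb
  rw [show m+2+c1+(u-c1-2*m)+(z-u+m) = z+2 by ring,
    show 2*m+c1+(u-c1-2*m)+2 = u+2 by ring, show 2*m+c1+(u-c1-2*m)+1 = u+1 by ring]
  have hne : (m+1)*(z-u+m+1) ≠ 0 := mul_ne_zero e7 e1
  apply mul_right_cancel₀ hne
  have hb' : W' * (c1+1+m) * ((m+1)*(z-u+m+1)) =
      -(W' * (-((m+1)*(c1+1+m)*(z-u+m+1)) / (u+2))) * (u+2) := by field_simp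
  rw [hb', ← hb]
  field_simp
  ring

/-- Total mass of the Racah weight. -/
lemma sum_racahWeight {c1 c2 c3 : ℝ} (h : Generic3 c1 c2 c3) (M : ℕ) :
    (∑ x ∈ Finset.range (M+1), racahWeight c3 c2 c1 M x) * racahWeight c1 c2 c3 M 0 = 1 := by
  obtain ⟨_, _, _, h12, _, h23, h123⟩ := id h
  have n12 (m : ℤ) := h12.add_intCast_ne_zero m
  induction M with
  | zero =>
    have e1 : c2+c1+1 ≠ 0 := by
      have := n12 1; push_cast at this; rwa [add_comm c1] at this
    have e2 : c2+c3+1 ≠ 0 := by simpa using h23.add_intCast_ne_zero 1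
    simp [racahWeight, poch, e1, e2]
  | succ M ih =>
    have e4 : c2+c3+2+(M:ℝ) ≠ 0 := by
      have := h23.add_intCast_ne_zero (2+M)
      push_cast at this; intro h0; exact this (by linarith)
    have e2 : (M:ℝ)+2+c1+c2+c3 ≠ 0 := by
      have := h123.add_intCast_ne_zero (M+2)
      push_cast at this; intro h0; exact this (by linarith)
    have e3 (x : ℕ) : c2+c1+x+1+((M:ℝ)+1) ≠ 0 := by
      have := n12 (x+M+2); push_cast at this; intro h0; exact this (by linarith)
    have e5 (x : ℕ) : 2*(x:ℝ)+c1+c2+1 ≠ 0 := by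
      have := n12 (2*x+1); push_cast at this; intro h0; exact this (by linarith)
    have e1 {x : ℕ} (hx : x ≤ M) : (M:ℝ)+1-x ≠ 0 := by
      have : (x:ℝ) ≤ M := by exact_mod_cast hx
      intro h0; linarith
    have hv := racahWeight_zero_succ h M
    set ρ : ℝ := (c1+1+M) / (c2+c3+2+M) with hρ
    set K : ℝ := -(2*M+3+c1+c2+c3)/((M+2+c1+c2+c3)*(c2+c3+2+M)) with hK
    have key : ∀ t ≤ M, ∑ x ∈ Finset.range (t+1),
        (racahWeight c3 c2 c1 (M+1) x * ρ - racahWeight c3 c2 c1 M x) =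
        K * ((t+c2+1)*(M+2+c1+c2+c3+t)*(t+c1+c2+1) / ((c2+c1+t+1+(M+1))*(2*t+c1+c2+1))) *
          racahWeight c3 c2 c1 M t := by
      intro t
      induction t with
      | zero =>
        intro h0
        rw [zero_add, Finset.sum_range_one, racahWeight_succ h h0]
        have := racah_wz_identity (e1 h0) e2 (e3 0) e4 (e5 0)
        rw [← hρ, ← hK] at this
        push_cast at this ⊢
        linear_combination (racahWeight c3 c2 c1 M 0) * this
      | succ t ih' =>
        intro ht
        rw [Finset.sum_range_succ, ih' (by omega), racahWeight_succ h ht]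
        have hwz := racah_wz_identity (e1 ht) e2 (e3 (t+1)) e4 (e5 (t+1))
        rw [← hρ, ← hK] at hwz
        have hb := racahWeight_balance h (show t < M by omega)
        have hG : (t+c2+1)*(M+2+c1+c2+c3+t)*(t+c1+c2+1) / ((c2+c1+t+1+((M:ℝ)+1))*(2*t+c1+c2+1)) *
            racahWeight c3 c2 c1 M t =
            ((t+1:ℕ):ℝ)*((t+1:ℕ)+c1)*(c3+1+(M-(t+1:ℕ))) /
              ((2*(t+1:ℕ)+c1+c2+1)*(M+1-(t+1:ℕ))) * racahWeight c3 c2 c1 M (t+1) := by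
          have f1 := e3 t
          have f2 := e5 t
          have f3 := e5 (t+1)
          have f4 := e1 ht
          have f5 : 2*(t:ℝ)+c1+c2+2 ≠ 0 := by
            have := n12 (2*t+2); push_cast at this; intro h0; exact this (by linarith)
          push_cast at f3 f4 ⊢
          generalize racahWeight c3 c2 c1 M t = W at hb ⊢
          generalize racahWeight c3 c2 c1 M (t+1) = W' at hb ⊢
          have g4 : (M:ℝ) - t ≠ 0 := by intro h0; exact f4 (by linarith)
          have q1 : (t+c2+1)*(M+2+c1+c2+c3+t)*(t+c1+c2+1) /
              ((c2+c1+t+1+((M:ℝ)+1))*(2*t+c1+c2+1)) = coefB t c1 c2 c3 M *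
                (-(2*t+c1+c2+2) / ((M-t)*(c2+c1+t+1+(M+1)))) := by
            rw [coefB, div_mul_div_comm, div_eq_div_iff (mul_ne_zero f1 f2)
              (mul_ne_zero (mul_ne_zero f2 f5) (mul_ne_zero g4 f1))]
            ring
          have q2 : ((t:ℝ)+1)*(t+1+c1)*(c3+1+(M-(t+1))) / ((2*(t+1)+c1+c2+1)*(M+1-(t+1))) =
              coefD (t+1) c1 c2 c3 M * (-(2*t+c1+c2+2) / ((M-t)*(c2+c1+t+1+(M+1)))) := by
            have f6 : 2*((t:ℝ)+1)+c1+c2 ≠ 0 := by intro h0; exact f5 (by linarith)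
            rw [coefD, div_mul_div_comm, div_eq_div_iff (mul_ne_zero f3 f4)
              (mul_ne_zero (mul_ne_zero f6 f3) (mul_ne_zero g4 f1))]
            ring
          rw [q1, q2]
          linear_combination (-(2*t+c1+c2+2) / ((M-t)*(c2+c1+t+1+(M+1)))) * hb
        rw [mul_assoc, hG]
        linear_combination (racahWeight c3 c2 c1 M (t+1)) * hwz
    have hk := key M le_rfl
    have hlast : racahWeight c3 c2 c1 (M+1) (M+1) * ρ +
        K * ((M+c2+1)*(M+2+c1+c2+c3+M)*(M+c1+c2+1) / ((c2+c1+M+1+(M+1))*(2*M+c1+c2+1))) *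
          racahWeight c3 c2 c1 M M = 0 := by
      rw [hρ, mul_div_assoc', racahWeight_last h M, hK]
      have f1 := e3 M
      have f2 := e5 M
      rw [show c2+c1+(M:ℝ)+1+(M+1) = 2*M+c1+c2+2 by ring] at f1 ⊢
      rw [show (M:ℝ)+2+c1+c2+c3+M = 2*M+2+c1+c2+c3 by ring]
      field_simp
      ring
    rw [Finset.sum_sub_distrib, ← Finset.sum_mul] at hk
    rw [Finset.sum_range_succ, hv]
    linear_combination (racahWeight c1 c2 c3 M 0) * hk + (racahWeight c1 c2 c3 M 0) * hlast + ih

/-- Orthogonality relation for the Racah polynomials. -/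
lemma sum_racahWeight_mul_racahSeries {c1 c2 c3 : ℝ} (h : Generic3 c1 c2 c3) {M n m : ℕ}
    (hn : n ≤ M) (hm : m ≤ M) :
    (∑ x ∈ Finset.range (M+1), racahWeight c3 c2 c1 M x * racahSeries c1 c2 c3 M n x *
      racahSeries c1 c2 c3 M m x) * racahWeight c1 c2 c3 M n = if n = m then 1 else 0 := by
  split_ifs with hnm
  swap
  · rw [racahSeries_orthogonal h hn hm hnm, zero_mul]
  subst hnm
  set W := racahWeight c3 c2 c1 M
  set V := racahWeight c1 c2 c3 M
  set R : ℕ → ℕ → ℝ := fun n x => racahSeries c1 c2 c3 M n x with hR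
  set H : ℕ → ℝ := fun n => ∑ x ∈ Finset.range (M+1), W x * R n x * R n x with hH
  set G : ℝ := ∑ n ∈ Finset.range (M+1), V n * R n 0 * R n 0 with hG
  have primal (i : ℕ) (hi : i ≤ M) (j : ℕ) (hj : j ≤ M) :
      ∑ x ∈ Finset.range (M+1), W x * R i x * R j x = if j = i then H i else 0 := by
    split_ifs with hij
    · rw [hij]
    · exact racahSeries_orthogonal h hi hj (Ne.symm hij)
  have dual (x : ℕ) (hx : x ≤ M) :
      ∑ i ∈ Finset.range (M+1), V i * R i x * R i 0 = if x = 0 then G else 0 := by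
    split_ifs with hx0
    · rw [hx0]
    · rw [← racahSeries_orthogonal h.reverse hx (Nat.zero_le M) hx0]
      refine Finset.sum_congr rfl fun i _ => ?_
      simp only [hR]
      rw [racahSeries_duality c1 c2 c3 M i x, racahSeries_duality c1 c2 c3 M i 0]
  -- Evaluate `R W Rᵀ V R` in two ways.
  have const (i : ℕ) (hi : i ≤ M) : H i * V i = W 0 * G := by
    have swap : ∑ j ∈ Finset.range (M+1), (∑ x ∈ Finset.range (M+1), W x * R i x * R j x) *
        (V j * R j 0) = ∑ x ∈ Finset.range (M+1), W x * R i x *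
          ∑ j ∈ Finset.range (M+1), V j * R j x * R j 0 := by
      simp only [Finset.sum_mul, Finset.mul_sum]
      rw [Finset.sum_comm]
      exact Finset.sum_congr rfl fun x _ => Finset.sum_congr rfl fun j _ => by ring
    have hR0 : R i 0 = 1 := by
      simpa [hR] using racahSeries_zero c1 c2 c3 M i
    have hleft : ∑ j ∈ Finset.range (M+1), (∑ x ∈ Finset.range (M+1), W x * R i x * R j x) *
        (V j * R j 0) = H i * (V i * R i 0) := by
      rw [Finset.sum_eq_single_of_mem i (Finset.mem_range.2 (by omega)) fun j hj hji => by
        rw [primal i hi j (Nat.lt_succ_iff.1 (Finset.mem_range.1 hj)), if_neg hji, zero_mul]]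
    have hright : ∑ x ∈ Finset.range (M+1), W x * R i x *
        ∑ j ∈ Finset.range (M+1), V j * R j x * R j 0 = W 0 * R i 0 * G := by
      rw [Finset.sum_eq_single_of_mem 0 (Finset.mem_range.2 (by omega)) fun x hx hx0 => by
        rw [dual x (Nat.lt_succ_iff.1 (Finset.mem_range.1 hx)), if_neg hx0, mul_zero]]
    rw [hleft, hright, hR0] at swap
    simpa using swap
  have hmass : H 0 * V 0 = 1 := by
    rw [← sum_racahWeight h M]
    refine congrArg (· * V 0) (Finset.sum_congr rfl fun x _ => ?_)
    have : R 0 x = 1 := by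
      simp only [hR]
      rw [racahSeries_duality, Nat.cast_zero, racahSeries_zero]
    rw [this]; ring
  change H n * V n = 1
  rw [const n hn, ← const 0 (Nat.zero_le M), hmass]

lemma Om_natCast (c1 c2 c3 : ℝ) (M n : ℕ) :
    Om (n:ℤ) c1 c2 c3 (M:ℤ) = racahWeight c1 c2 c3 M n := by
  simp [Om, racahWeight]

lemma racah_natCast (c1 c2 c3 x : ℝ) {M n : ℕ} (hn : n ≤ M) :
    racah (n:ℤ) x c1 c2 c3 (M:ℤ) = racahWeight c1 c2 c3 M n * racahSeries c1 c2 c3 M n x := by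
  rw [racah, if_pos (by omega), Om_natCast, racahSeries]
  congr 1
  rw [Int.toNat_natCast,
    ← Finset.sum_subset (Finset.range_mono (Nat.succ_le_succ hn)) (fun k _ hk => ?_)]
  · refine Finset.sum_congr rfl fun k _ => ?_
    simp only [racahCoeff, racahBasis, Int.cast_natCast, ← add_assoc]
    ring
  · have : n < k := by simpa [Nat.lt_succ_iff] using hk
    simp [racahCoeff, poch_neg_eq_zero this]

lemma racah_of_lt (c1 c2 c3 x : ℝ) {M n : ℕ} (hn : M < n) :
    racah (n:ℤ) x c1 c2 c3 (M:ℤ) = 0 := by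
  rw [racah, if_neg (by omega)]

/-- Orthogonality relation for the renormalized Racah polynomials. -/
lemma racah_orthogonality {c1 c2 c3 : ℝ} (h : Generic3 c1 c2 c3) (M n m : ℕ) :
    ∑ x ∈ Finset.range (M+1), racahWeight c3 c2 c1 M x * racah (n:ℤ) x c1 c2 c3 (M:ℤ) *
      racah (m:ℤ) x c1 c2 c3 (M:ℤ) = if n = m ∧ n ≤ M then racahWeight c1 c2 c3 M n else 0 := by
  rcases lt_or_ge M n with hn | hn
  · rw [if_neg (by omega)]
    exact Finset.sum_eq_zero fun x _ => by rw [racah_of_lt _ _ _ _ hn]; ring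
  rcases lt_or_ge M m with hm | hm
  · rw [if_neg (by omega)]
    exact Finset.sum_eq_zero fun x _ => by rw [racah_of_lt _ _ _ _ hm]; ring
  have key := sum_racahWeight_mul_racahSeries h hn hm
  calc _ = ((∑ x ∈ Finset.range (M+1), racahWeight c3 c2 c1 M x * racahSeries c1 c2 c3 M n x *
      racahSeries c1 c2 c3 M m x) * racahWeight c1 c2 c3 M n) * racahWeight c1 c2 c3 M m := by
        simp only [Finset.sum_mul]
        refine Finset.sum_congr rfl fun x _ => ?_
        rw [racah_natCast _ _ _ _ hn, racah_natCast _ _ _ _ hm]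
        ring
    _ = _ := by
        rw [key]
        by_cases hnm : n = m
        · subst hnm; simp [hn]
        · simp [hnm]

/-- Exchange of the weights `Λ` and `Ω` under swapping the roles of `x` and `j`. -/
lemma Lam_mul_racahWeight {c1 c2 c3 c4 c0 : ℝ} (h12 : Generic (c1+c2)) (h04 : Generic (c0+c4))
    {N x j : ℕ} (hc0 : c0 = -2*(N:ℝ)-3-c1-c2-c3-c4) (hxj : x + j ≤ N) :
    Lam (x:ℤ) c1 c2 (N:ℤ) * racahWeight c3 c0 c4 (N-x) j =
      Lam (j:ℤ) c4 c0 (N:ℤ) * racahWeight c3 c2 c1 (N-j) x := by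
  have hc : (N.choose x : ℝ) * (N-x).choose j = N.choose j * (N-j).choose x := by
    obtain ⟨d, rfl⟩ : ∃ d, N = x + j + d := ⟨N - x - j, by omega⟩
    have a1 := Nat.choose_mul (n := x + j + d) (k := x + j) (s := x) (by omega)
    have a2 := Nat.choose_mul (n := x + j + d) (k := x + j) (s := j) (by omega)
    rw [show x + j - x = j by omega] at a1
    rw [show x + j - j = x by omega] at a2
    have a3 : (x+j).choose x = (x+j).choose j := Nat.choose_symm_add
    rw [a3] at a1
    exact_mod_cast a1.symm.trans a2
  have p1 := poch_add_reflect (x+c1+c2+1) (N-j+1) j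
  have p2 := poch_add_reflect (j+c4+c0+1) (N-x+1) x
  rw [show N - j + 1 + j = N + 1 by omega] at p1
  rw [show N - x + 1 + x = N + 1 by omega] at p2
  push_cast [Nat.cast_sub (show j ≤ N by omega)] at p1
  push_cast [Nat.cast_sub (show x ≤ N by omega)] at p2
  have n1 := h12.poch_ne_zero (x+1) (a := x+c1+c2+1) (by push_cast; ring)
  have n2 := h04.poch_ne_zero (j+1) (a := j+c4+c0+1) (by push_cast; ring)
  have n3 := n1 (N+1)
  have n4 := n2 (N+1)
  have s1 : ((-1:ℝ)^j) * (-1)^j = 1 := by rw [← mul_pow]; norm_num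
  have s2 : ((-1:ℝ)^x) * (-1)^x = 1 := by rw [← mul_pow]; norm_num
  rw [p1] at n3
  rw [p2] at n4
  simp only [Lam, racahWeight, Int.toNat_natCast, Int.cast_natCast,
    show N - x - j = N - j - x by omega]
  push_cast [Nat.cast_sub (show j ≤ N by omega), Nat.cast_sub (show x ≤ N by omega)]
  rw [p1, p2, show c0+c4+(j:ℝ)+1 = j+c4+c0+1 by ring, show c2+c1+(x:ℝ)+1 = x+c1+c2+1 by ring,
    show (N:ℝ)-x+2+c3+c0+c4 = -(x+c1+c2+1+(N-j+1)+j-1) by rw [hc0]; ring,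
    show (N:ℝ)-j+2+c3+c2+c1 = -(j+c4+c0+1+(N-x+1)+x-1) by rw [hc0]; ring]
  have m1 := left_ne_zero_of_mul n3
  have m2 := left_ne_zero_of_mul n4
  have m3 := right_ne_zero_of_mul m1
  have m4 := right_ne_zero_of_mul m2
  have alg (X Y C C' D D' a b P Q E A B p q r t : ℝ) (hX : X*X = 1) (hY : Y*Y = 1)
      (hC : C*C' = D*D') (hp : p ≠ 0) (hq : q ≠ 0) :
      X*C*a*P/(A*(Y*p*r)) * (C'*b*Q*p*E/(B*t)) = Y*D*b*Q/(B*(X*q*t)) * (D'*a*P*q*E/(A*r)) := by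
    have hXi : X⁻¹ = X := inv_eq_of_mul_eq_one_left hX
    have hYi : Y⁻¹ = Y := inv_eq_of_mul_eq_one_left hY
    simp only [div_eq_mul_inv, mul_inv, hXi, hYi]
    linear_combination (X*Y*a*b*P*Q*E*A⁻¹*B⁻¹*r⁻¹*t⁻¹*(p*p⁻¹)) * hC +
      (X*Y*a*b*P*Q*E*A⁻¹*B⁻¹*r⁻¹*t⁻¹*D*D') * (mul_inv_cancel₀ hp - mul_inv_cancel₀ hq)
  have := alg _ _ _ _ _ _ (2*(x:ℝ)+c1+c2+1) (2*(j:ℝ)+c4+c0+1) (poch (c2+1) x) (poch (c0+1) j)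
    (poch (c3+1) (N-j-x)) (poch (c1+1) x) (poch (c4+1) j) _ _
    (poch (x+c1+c2+1) (N-j+1)) (poch (j+c4+c0+1) (N-x+1)) s2 s1 hc m3 m4
  convert this using 3 <;> ring

/-- orthogonality relation for the Tratnik polynomials of Racah type. -/
theorem tratnik_orthogonality
    (Nn : ℕ) (c1 c2 c3 c4 : ℝ) (hgen : Generic4 c1 c2 c3 c4)
    (c0 : ℝ) (hc0 : c0 = -2*(Nn:ℝ)-3-c1-c2-c3-c4)
    (i j k l : ℤ) (hi : 0 ≤ i) (hj : 0 ≤ j) (hij : i + j ≤ (Nn:ℤ))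
    (hk : 0 ≤ k) (hl : 0 ≤ l) (hkl : k + l ≤ (Nn:ℤ)) :
    ∑ x ∈ Finset.range (Nn+1), ∑ y ∈ Finset.range (Nn+1-x),
      Lam (x:ℤ) c1 c2 (Nn:ℤ) * Om (y:ℤ) c4 c0 c3 ((Nn:ℤ)-(x:ℤ)) *
        trat c1 c2 c3 c4 Nn i j (x:ℤ) (y:ℤ) * trat c1 c2 c3 c4 Nn k l (x:ℤ) (y:ℤ) =
      (if i = k ∧ j = l then Lam j c4 c0 (Nn:ℤ) * Om i c1 c2 c3 ((Nn:ℤ)-j) else 0) := by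
  obtain ⟨h1, h2, h3, h4, h12, h13, h14, h23, h24, h34, h123, h124, h134, h234, h1234⟩ := hgen
  have h04 : Generic (c0+c4) :=
    h123.int_sub (-2*Nn-3) (by rw [hc0]; push_cast; ring)
  have hg0 : Generic3 c3 c0 c4 :=
    ⟨h3, h1234.int_sub (-2*Nn-3) (by rw [hc0]; push_cast; ring), h4,
      h124.int_sub (-2*Nn-3) (by rw [hc0]; push_cast; ring), h34, h04,
      h12.int_sub (-2*Nn-3) (by rw [hc0]; push_cast; ring)⟩
  have hg : Generic3 c1 c2 c3 := ⟨h1, h2, h3, h12, h13, h23, h123⟩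
  lift i to ℕ using hi
  lift j to ℕ using hj
  lift k to ℕ using hk
  lift l to ℕ using hl
  have hij' : i + j ≤ Nn := by exact_mod_cast hij
  have hkl' : k + l ≤ Nn := by exact_mod_cast hkl
  have inner (x : ℕ) (hx : x ∈ Finset.range (Nn+1)) :
      ∑ y ∈ Finset.range (Nn+1-x),
        Lam (x:ℤ) c1 c2 (Nn:ℤ) * Om (y:ℤ) c4 c0 c3 ((Nn:ℤ)-(x:ℤ)) *
          trat c1 c2 c3 c4 Nn i j (x:ℤ) (y:ℤ) * trat c1 c2 c3 c4 Nn k l (x:ℤ) (y:ℤ) =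
      Lam (x:ℤ) c1 c2 (Nn:ℤ) * racah i x c1 c2 c3 ((Nn:ℤ)-j) * racah k x c1 c2 c3 ((Nn:ℤ)-l) *
        if j = l ∧ j ≤ Nn - x then racahWeight c3 c0 c4 (Nn-x) j else 0 := by
    have hxN : x ≤ Nn := Nat.lt_succ_iff.1 (Finset.mem_range.1 hx)
    rw [← racah_orthogonality hg0, Finset.mul_sum, show Nn + 1 - x = Nn - x + 1 by omega]
    refine Finset.sum_congr rfl fun y hy => ?_
    have hy' := Finset.mem_range.1 hy
    rw [trat, trat, if_pos (by omega), if_pos (by omega), ← hc0,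
      ← Nat.cast_sub (R := ℤ) hxN, Om_natCast]
    push_cast
    ring
  rw [Finset.sum_congr rfl inner]
  by_cases hjl : j = l
  swap
  · rw [if_neg fun h => hjl (by exact_mod_cast h.2)]
    exact Finset.sum_eq_zero fun x _ => by rw [if_neg fun h => hjl h.1, mul_zero]
  subst hjl
  rw [← Finset.sum_subset (Finset.range_mono (show Nn - j + 1 ≤ Nn + 1 by omega))
    (fun x hx hx' => by
      rw [Finset.mem_range] at hx hx'
      rw [if_neg (by omega), mul_zero]), ← Nat.cast_sub (R := ℤ) (show j ≤ Nn by omega)]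
  calc _ = ∑ x ∈ Finset.range (Nn-j+1), Lam (j:ℤ) c4 c0 (Nn:ℤ) * (racahWeight c3 c2 c1 (Nn-j) x *
        racah i x c1 c2 c3 ((Nn-j : ℕ):ℤ) * racah k x c1 c2 c3 ((Nn-j : ℕ):ℤ)) := by
        refine Finset.sum_congr rfl fun x hx => ?_
        rw [Finset.mem_range] at hx
        rw [if_pos (by omega)]
        have := Lam_mul_racahWeight h12 h04 hc0 (show x + j ≤ Nn by omega)
        linear_combination racah i x c1 c2 c3 ((Nn-j : ℕ):ℤ) *
          racah k x c1 c2 c3 ((Nn-j : ℕ):ℤ) * this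
    _ = _ := by
        rw [← Finset.mul_sum, racah_orthogonality hg, Om_natCast]
        by_cases hik : i = k
        · rw [if_pos ⟨hik, by omega⟩, if_pos ⟨by exact_mod_cast hik, rfl⟩]
        · rw [if_neg fun h => hik h.1, if_neg fun h => hik (by exact_mod_cast h.1), mul_zero]
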